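/- Let G be a finite simple graph that is C_3-free, C_5-free and C_6-free. If R is a minimal redundant set of G containing exactly 2 redundant vertices (|red(R)| = 2), then either R = N[x] for some x ∈ red(R), or |R| = 3. -/

import Mathlib

open Set SimpleGraph

variable {V : Type*}

/-- The closed neighborhood `N[v]` of a vertex. -/
def closedNbr (G : SimpleGraph V) (v : V) : Set V := insert v (G.neighborSet v)

/-- Private neighbors of `x` with respect to `I`. -/
def privSet (G : SimpleGraph V) (x : V) (I : Set V) : Set V :=
  {y ∈ closedNbr G x | closedNbr G y ∩ I = {x}}

/-- A set is irredundant if every element has a private neighbor. -/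
def Irred (G : SimpleGraph V) (I : Set V) : Prop := ∀ x ∈ I, (privSet G x I).Nonempty

/-- A maximal irredundant set. -/
def MaxIrred (G : SimpleGraph V) (I : Set V) : Prop :=
  Irred G I ∧ ∀ J : Set V, Irred G J → I ⊆ J → J = I

def Redundant (G : SimpleGraph V) (R : Set V) : Prop := ¬ Irred G R

def MinRedundant (G : SimpleGraph V) (R : Set V) : Prop :=
  Redundant G R ∧ ∀ S : Set V, S ⊂ R → ¬ Redundant G S

/-- The set of redundant vertices of a set. -/
def redVerts (G : SimpleGraph V) (R : Set V) : Set V := {x ∈ R | privSet G x R = ∅}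

def Dominating (G : SimpleGraph V) (D : Set V) : Prop := ∀ v : V, ∃ d ∈ D, v ∈ closedNbr G d

def MinDominating (G : SimpleGraph V) (D : Set V) : Prop :=
  Dominating G D ∧ ∀ S : Set V, S ⊂ D → ¬ Dominating G S

/-- Vertices at distance at most 2 from `x`. -/
def ball2 (G : SimpleGraph V) (x : V) : Set V :=
  {y | y = x ∨ G.Adj x y ∨ ∃ w, G.Adj x w ∧ G.Adj w y}

/-- Vertices at distance exactly 2 from `x`. -/
def sphere2 (G : SimpleGraph V) (x : V) : Set V :=
  {y | y ≠ x ∧ ¬ G.Adj x y ∧ ∃ w, G.Adj x w ∧ G.Adj w y}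

/-- `G` contains no induced cycle of length `k`. -/
def CFree (G : SimpleGraph V) (k : ℕ) : Prop :=
  IsEmpty (SimpleGraph.cycleGraph k ↪g G)

/-- `S` dominates `B` through open neighborhoods. -/
def DomOver (G : SimpleGraph V) (S B : Set V) : Prop := ∀ b ∈ B, ∃ s ∈ S, G.Adj s b

def MinDomOver (G : SimpleGraph V) (S B : Set V) : Prop :=
  DomOver G S B ∧ ∀ S' : Set V, S' ⊂ S → ¬ DomOver G S' B

/-- `N(Y)`, the union of open neighborhoods of elements of `Y`. -/
def nbrUnion (G : SimpleGraph V) (Y : Set V) : Set V := ⋃ y ∈ Y, G.neighborSet y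

/-- Private edges of `x` with respect to `I` in a hypergraph. -/
def hypPriv (H : Set (Set V)) (x : V) (I : Set V) : Set (Set V) := {E ∈ H | E ∩ I = {x}}

def HypIrred (H : Set (Set V)) (I : Set V) : Prop := ∀ x ∈ I, (hypPriv H x I).Nonempty

def HypMaxIrred (H : Set (Set V)) (I : Set V) : Prop :=
  HypIrred H I ∧ ∀ J : Set V, HypIrred H J → I ⊆ J → J = I

/-- The trace of a hypergraph on a set `S`. -/
def htrace (H : Set (Set V)) (S : Set V) : Set (Set V) :=
  {F | ∃ E ∈ H, F = E ∩ S ∧ (E ∩ S).Nonempty}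

/-- The closed-neighborhood hypergraph of a graph. -/
def nbrHyp (G : SimpleGraph V) : Set (Set V) := Set.range (closedNbr G)

/-- The first `i` vertices in the ordering `v` (zero-based: `v 0, …, v (i-1)`). -/
def firstVerts (v : ℕ → V) (i : ℕ) : Set V := {x | ∃ j < i, v j = x}

/-- The incidence co-bipartite graph of the closed-neighborhood hypergraph of `G`:
`Sum.inl` is the vertex side `V`, `Sum.inr` is the copy `U`. -/
def cobip (G : SimpleGraph V) : SimpleGraph (V ⊕ V) :=
  SimpleGraph.fromRel (fun a b => match a, b with
    | Sum.inl _, Sum.inl _ => True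
    | Sum.inr _, Sum.inr _ => True
    | Sum.inl a, Sum.inr b => a = b ∨ G.Adj a b
    | Sum.inr _, Sum.inl _ => False)

theorem CFree.false_of_adj_iff {G : SimpleGraph V} {n : ℕ} (h : CFree G n) (f : Fin n → V)
    (hf : ∀ i j, G.Adj (f i) (f j) ↔ (cycleGraph n).Adj i j)
    (hsep : ∀ i j : Fin n,
      (∀ k, (cycleGraph n).Adj i k ↔ (cycleGraph n).Adj j k) → i = j) : False :=
  h.false ⟨⟨f, fun i j hij => hsep i j fun k => by rw [← hf, ← hf, hij]⟩, fun {i j} => hf i j⟩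

theorem CFree.not_triangle {G : SimpleGraph V} (h : CFree G 3) {a b c : V}
    (ab : G.Adj a b) (bc : G.Adj b c) (ca : G.Adj c a) : False := by
  refine h.false_of_adj_iff ![a, b, c] (fun i j => ?_) (by decide)
  fin_cases i <;> fin_cases j <;>
    first
    | exact iff_of_false G.irrefl (by decide)
    | exact iff_of_true (by assumption) (by decide)
    | exact iff_of_true (G.adj_symm (by assumption)) (by decide)

theorem CFree.not_induced_five {G : SimpleGraph V} (h : CFree G 5) {a b c d e : V}
    (ab : G.Adj a b) (bc : G.Adj b c) (cd : G.Adj c d) (de : G.Adj d e) (ea : G.Adj e a)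
    (ac : ¬ G.Adj a c) (ad : ¬ G.Adj a d) (bd : ¬ G.Adj b d) (be : ¬ G.Adj b e)
    (ce : ¬ G.Adj c e) : False := by
  refine h.false_of_adj_iff ![a, b, c, d, e] (fun i j => ?_) (by decide)
  fin_cases i <;> fin_cases j <;>
    first
    | exact iff_of_false G.irrefl (by decide)
    | exact iff_of_true (by assumption) (by decide)
    | exact iff_of_true (G.adj_symm (by assumption)) (by decide)
    | exact iff_of_false (by assumption) (by decide)
    | exact iff_of_false (mt G.adj_symm (by assumption)) (by decide)

theorem CFree.not_induced_six {G : SimpleGraph V} (h : CFree G 6) {a b c d e f : V}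
    (ab : G.Adj a b) (bc : G.Adj b c) (cd : G.Adj c d) (de : G.Adj d e) (ef : G.Adj e f)
    (fa : G.Adj f a) (ac : ¬ G.Adj a c) (ad : ¬ G.Adj a d) (ae : ¬ G.Adj a e)
    (bd : ¬ G.Adj b d) (be : ¬ G.Adj b e) (bf : ¬ G.Adj b f) (ce : ¬ G.Adj c e)
    (cf : ¬ G.Adj c f) (df : ¬ G.Adj d f) : False := by
  refine h.false_of_adj_iff ![a, b, c, d, e, f] (fun i j => ?_) (by decide)
  fin_cases i <;> fin_cases j <;>
    first
    | exact iff_of_false G.irrefl (by decide)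
    | exact iff_of_true (by assumption) (by decide)
    | exact iff_of_true (G.adj_symm (by assumption)) (by decide)
    | exact iff_of_false (by assumption) (by decide)
    | exact iff_of_false (mt G.adj_symm (by assumption)) (by decide)

theorem exists_ne_mem_closedNbr_of_mem_redVerts {G : SimpleGraph V} {R : Set V} {x y : V}
    (hx : x ∈ redVerts G R) (hy : y ∈ closedNbr G x) : ∃ r ∈ R, r ≠ x ∧ r ∈ closedNbr G y := by
  by_contra! hne
  refine (hx.2 ▸ notMem_empty y : y ∉ privSet G x R) ⟨hy, ?_⟩
  ext r
  simp only [mem_inter_iff, mem_singleton_iff]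
  refine ⟨fun hr => by_contra fun hrx => hne r hr.2 hrx hr.1, ?_⟩
  rintro rfl
  exact ⟨hy.imp Eq.symm fun h => G.adj_symm h, hx.1⟩

/-- In a minimal redundant set, every redundant vertex `x` shares with each other vertex `z` of the
set a closed neighborhood containing no further vertex of the set. -/
theorem MinRedundant.exists_closedNbr_inter_eq_pair {G : SimpleGraph V} {R : Set V} {x z : V}
    (hR : MinRedundant G R) (hx : x ∈ redVerts G R) (hz : z ∈ R) (hzx : z ≠ x) :
    ∃ y, closedNbr G y ∩ R = {x, z} := by
  have hirr : Irred G (R \ {z}) :=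
    not_not.mp (hR.2 _ ⟨sdiff_subset, fun hsub => (hsub hz).2 rfl⟩)
  obtain ⟨y, hy, hyR⟩ := hirr x ⟨hx.1, hzx.symm⟩
  obtain ⟨r, hr, hrx, hry⟩ := exists_ne_mem_closedNbr_of_mem_redVerts hx hy
  have key : ∀ s, s ∈ closedNbr G y ∧ s ∈ R ∧ s ≠ z ↔ s = x := Set.ext_iff.mp hyR
  have hrz : r = z := by_contra fun h => hrx ((key r).mp ⟨hry, hr, h⟩)
  refine ⟨y, Set.ext fun s => ?_⟩
  have := key s
  simp only [mem_inter_iff, mem_insert_iff, mem_singleton_iff]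
  grind

/-- If the common neighborhood of two adjacent redundant vertices `a` and `b` is witnessed by `a`,
then the set is the closed neighborhood of `b`. -/
theorem MinRedundant.eq_closedNbr {G : SimpleGraph V} (h3 : CFree G 3) (h5 : CFree G 5)
    {R : Set V} {a b : V} (hR : MinRedundant G R) (ha : a ∈ redVerts G R)
    (hb : b ∈ redVerts G R) (hab : G.Adj a b) (hinter : closedNbr G a ∩ R = {a, b}) :
    R = closedNbr G b := by
  have ha' : ∀ s, (s = a ∨ G.Adj a s) ∧ s ∈ R ↔ s = a ∨ s = b := Set.ext_iff.mp hinter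
  have hsub : ∀ z ∈ R, z = b ∨ G.Adj b z := by
    intro z hz
    by_contra! hbz
    have hza : z ≠ a := by rintro rfl; exact hbz.2 hab.symm
    have haz : ¬ G.Adj a z := fun h => by
      rcases (ha' z).mp ⟨Or.inr h, hz⟩ with h | h
      · exact hza h
      · exact hbz.1 h
    obtain ⟨p, hp⟩ := hR.exists_closedNbr_inter_eq_pair ha hz hza
    obtain ⟨q, hq⟩ := hR.exists_closedNbr_inter_eq_pair hb hz hbz.1
    replace hp : ∀ s, (s = p ∨ G.Adj p s) ∧ s ∈ R ↔ s = a ∨ s = z := Set.ext_iff.mp hp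
    replace hq : ∀ s, (s = q ∨ G.Adj q s) ∧ s ∈ R ↔ s = b ∨ s = z := Set.ext_iff.mp hq
    have hpa : G.Adj p a := by grind [G.adj_comm, G.irrefl]
    have hpz : G.Adj p z := by grind [G.adj_comm, G.irrefl]
    have hqb : G.Adj q b := by grind [G.adj_comm, G.irrefl]
    have hqz : G.Adj q z := by grind [G.adj_comm, G.irrefl]
    have hpb : ¬ G.Adj p b := fun h => h3.not_triangle h hab.symm hpa.symm
    have hqa : ¬ G.Adj q a := fun h => h3.not_triangle h hab hqb.symm
    exact h5.not_induced_five hab hqb.symm hqz hpz.symm hpa (fun h => hqa h.symm) haz hbz.2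
      (fun h => hpb h.symm) fun h => h3.not_triangle h hpz hqz.symm
  refine Subset.antisymm hsub fun y hy => ?_
  obtain ⟨r, hr, hrb, hry⟩ := exists_ne_mem_closedNbr_of_mem_redVerts hb hy
  rcases hy with rfl | hy
  · exact hb.1
  rcases hry with rfl | hry
  · exact hr
  exact (h3.not_triangle hy hry ((hsub r hr).resolve_left hrb).symm).elim

/-- Every further vertex of the set is adjacent to each of two nonadjacent redundant vertices. -/
theorem MinRedundant.adj_of_not_adj {G : SimpleGraph V} (h3 : CFree G 3) (h5 : CFree G 5)
    (h6 : CFree G 6) {R : Set V} {a b z : V} (hR : MinRedundant G R) (ha : a ∈ redVerts G R)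
    (hb : b ∈ redVerts G R) (hne : a ≠ b) (hab : ¬ G.Adj a b) (hz : z ∈ R) (hza : z ≠ a)
    (hzb : z ≠ b) : G.Adj b z := by
  by_contra hbz
  have haR := ha.1
  have hbR := hb.1
  obtain ⟨w, hw⟩ := hR.exists_closedNbr_inter_eq_pair ha hb.1 hne.symm
  obtain ⟨p, hp⟩ := hR.exists_closedNbr_inter_eq_pair ha hz hza
  obtain ⟨q, hq⟩ := hR.exists_closedNbr_inter_eq_pair hb hz hzb
  replace hw : ∀ s, (s = w ∨ G.Adj w s) ∧ s ∈ R ↔ s = a ∨ s = b := Set.ext_iff.mp hw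
  replace hp : ∀ s, (s = p ∨ G.Adj p s) ∧ s ∈ R ↔ s = a ∨ s = z := Set.ext_iff.mp hp
  replace hq : ∀ s, (s = q ∨ G.Adj q s) ∧ s ∈ R ↔ s = b ∨ s = z := Set.ext_iff.mp hq
  have hwa : G.Adj w a := by grind [G.adj_comm, G.irrefl]
  have hwb : G.Adj w b := by grind [G.adj_comm, G.irrefl]
  have hwz : ¬ G.Adj w z := by grind [G.adj_comm, G.irrefl]
  have hqb : G.Adj q b := by grind [G.adj_comm, G.irrefl]
  have hqz : G.Adj q z := by grind [G.adj_comm, G.irrefl]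
  have hqa : ¬ G.Adj q a := by grind [G.adj_comm, G.irrefl]
  have hwq : ¬ G.Adj w q := fun h => h3.not_triangle h hqb hwb.symm
  by_cases haz : G.Adj a z
  · exact h5.not_induced_five hwa.symm hwb hqb.symm hqz haz.symm hab (fun h => hqa h.symm) hwq
      hwz hbz
  · have hpa : G.Adj p a := by grind [G.adj_comm, G.irrefl]
    have hpz : G.Adj p z := by grind [G.adj_comm, G.irrefl]
    have hpb : ¬ G.Adj p b := by grind [G.adj_comm, G.irrefl]
    exact h6.not_induced_six hwa.symm hwb hqb.symm hqz hpz.symm hpa hab (fun h => hqa h.symm)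
      haz hwq hwz (fun h => h3.not_triangle h hpa hwa.symm) hbz (fun h => hpb h.symm)
      fun h => h3.not_triangle h hpz hqz.symm

/-- in a `(C₃, C₅, C₆)`-free graph, a minimal redundant set with exactly 2
redundant vertices is either the closed neighborhood of one of its redundant vertices, or
has exactly 3 elements. -/
theorem stmt15 [Fintype V] (G : SimpleGraph V) (h3 : CFree G 3) (h5 : CFree G 5)
    (h6 : CFree G 6) (R : Set V) (hR : MinRedundant G R)
    (hred : (redVerts G R).ncard = 2) :
    (∃ x ∈ redVerts G R, R = closedNbr G x) ∨ R.ncard = 3 := by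
  obtain ⟨a, b, hne, hab⟩ := Set.ncard_eq_two.mp hred
  have ha : a ∈ redVerts G R := by simp [hab]
  have hb : b ∈ redVerts G R := by simp [hab]
  by_cases hadj : G.Adj a b
  · left
    obtain ⟨w, hw⟩ := hR.exists_closedNbr_inter_eq_pair ha hb.1 hne.symm
    have haw : a ∈ closedNbr G w ∩ R := by simp [hw]
    have hbw : b ∈ closedNbr G w ∩ R := by simp [hw]
    rcases haw.1 with rfl | haw
    · exact ⟨b, hb, hR.eq_closedNbr h3 h5 ha hb hadj hw⟩
    rcases hbw.1 with rfl | hbw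
    · exact ⟨a, ha, hR.eq_closedNbr h3 h5 hb ha hadj.symm (pair_comm a b ▸ hw)⟩
    exact (h3.not_triangle haw hadj hbw.symm).elim
  · right
    have hz : ∀ z ∈ R, z ≠ a → z ≠ b → G.Adj a z ∧ G.Adj b z := fun z hz hza hzb =>
      ⟨hR.adj_of_not_adj h3 h5 h6 hb ha hne.symm (fun h => hadj h.symm) hz hzb hza,
        hR.adj_of_not_adj h3 h5 h6 ha hb hne hadj hz hza hzb⟩
    obtain ⟨z, hzR, hza, haz⟩ := exists_ne_mem_closedNbr_of_mem_redVerts ha (Or.inl rfl)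
    replace haz : G.Adj a z := haz.resolve_left hza
    have hzb : z ≠ b := by rintro rfl; exact hadj haz
    obtain ⟨p, hp⟩ := hR.exists_closedNbr_inter_eq_pair ha hzR hza
    have haR := ha.1
    have hbR := hb.1
    replace hp : ∀ s, (s = p ∨ G.Adj p s) ∧ s ∈ R ↔ s = a ∨ s = z := Set.ext_iff.mp hp
    have hbz := (hz z hzR hza hzb).2
    have hpa : p = a := by
      by_contra hpa
      have hpa' : G.Adj p a := by grind
      have hpz : p ≠ z := by rintro rfl; grind [G.adj_comm]
      exact h3.not_triangle hpa' haz (by grind [G.adj_comm])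
    refine Set.ncard_eq_three.mpr ⟨a, b, z, hne, hza.symm, hzb.symm, ?_⟩
    ext s
    simp only [mem_insert_iff, mem_singleton_iff]
    grind
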